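/- Fix positive integers m and k and a real number b with 0 < b < mk/(m+k), and for each n let p_n = n^{−1/b}. Then the probability under G(n, p_n) that there exists some k-element subset of [n] that is a face of N_m(G) (i.e., has at least m common neighbors) tends to 0 as n → ∞. -/

import Mathlib

open MeasureTheory

/-- Configuration of edge indicators for a graph on vertex set `Fin n`. -/
abbrev EdgeCfg (n : ℕ) := {e : Sym2 (Fin n) // ¬ e.IsDiag} → Bool

/-- Bernoulli measure on `Bool` with success probability `p`. -/
noncomputable def bern (p : ℝ) : Measure Bool :=
  ENNReal.ofReal p • Measure.dirac true + ENNReal.ofReal (1 - p) • Measure.dirac false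

/-- The Erdős–Rényi measure `G(n,p)`: edge indicators are i.i.d. Bernoulli(p). -/
noncomputable def erdosRenyi (n : ℕ) (p : ℝ) : Measure (EdgeCfg n) :=
  Measure.pi fun _ => bern p

/-- `u` and `v` are adjacent in the graph encoded by `ω`. -/
def Adj {n : ℕ} (ω : EdgeCfg n) (u v : Fin n) : Prop :=
  ∃ h : u ≠ v, ω ⟨s(u, v), by simpa [Sym2.mk_isDiag_iff] using h⟩ = true

open Classical in
/-- The set of common neighbors of `S`. -/
noncomputable def commonNbrs {n : ℕ} (ω : EdgeCfg n) (S : Finset (Fin n)) : Finset (Fin n) :=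
  Finset.univ.filter fun v => v ∉ S ∧ ∀ u ∈ S, Adj ω v u

/-- `S` is a face of the `m`-neighbor complex of the graph encoded by `ω`. -/
def IsFace {n : ℕ} (ω : EdgeCfg n) (m : ℕ) (S : Finset (Fin n)) : Prop :=
  m ≤ (commonNbrs ω S).card

lemma bern_singleton_true (p : ℝ) : bern p {true} = ENNReal.ofReal p := by
  simp [bern]

lemma isProbabilityMeasure_bern {p : ℝ} (h0 : 0 ≤ p) (h1 : p ≤ 1) :
    IsProbabilityMeasure (bern p) where
  measure_univ := by
    simp [bern, ← ENNReal.ofReal_add h0 (sub_nonneg.2 h1)]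

lemma erdosRenyi_forall_eq_true {n : ℕ} {p : ℝ} (h0 : 0 ≤ p) (h1 : p ≤ 1)
    (E : Finset {e : Sym2 (Fin n) // ¬ e.IsDiag}) :
    erdosRenyi n p {ω | ∀ e ∈ E, ω e = true} = ENNReal.ofReal p ^ E.card := by
  classical
  have := isProbabilityMeasure_bern h0 h1
  have hset : {ω : EdgeCfg n | ∀ e ∈ E, ω e = true} =
      Set.univ.pi fun e => if e ∈ E then {true} else Set.univ := by
    ext ω
    simp only [Set.mem_ofPred_eq, Set.mem_pi, Set.mem_univ, true_implies]
    refine forall_congr' fun e => ?_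
    by_cases he : e ∈ E <;> simp [he]
  rw [hset, erdosRenyi, Measure.pi_pi]
  simp only [apply_ite, measure_univ, bern_singleton_true]
  simp

/-- Pairs from disjoint sets determine distinct unordered edges. -/
lemma card_image_sym2Mk_of_disjoint {α : Type*} [DecidableEq α] {S T : Finset α}
    (h : Disjoint S T) :
    ((T ×ˢ S).image fun q => s(q.1, q.2)).card = T.card * S.card := by
  rw [Finset.card_image_of_injOn, Finset.card_product]
  rintro ⟨a, b⟩ hab ⟨c, d⟩ hcd heq
  simp only [Finset.coe_product, Set.mem_prod, Finset.mem_coe] at hab hcd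
  rcases Sym2.eq_iff.1 heq with ⟨rfl, rfl⟩ | ⟨rfl, rfl⟩
  · rfl
  · exact (Finset.disjoint_left.1 h hcd.2 hab.1).elim

lemma erdosRenyi_forall_adj_le {n : ℕ} {p : ℝ} (h0 : 0 ≤ p) (h1 : p ≤ 1)
    (S T : Finset (Fin n)) :
    erdosRenyi n p {ω | Disjoint S T ∧ ∀ v ∈ T, ∀ u ∈ S, Adj ω v u} ≤
      ENNReal.ofReal p ^ (T.card * S.card) := by
  classical
  by_cases hST : Disjoint S T
  · let E : Finset {e : Sym2 (Fin n) // ¬ e.IsDiag} :=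
      ((T ×ˢ S).image fun q => s(q.1, q.2)).subtype fun e => ¬ e.IsDiag
    have hE : E.card = T.card * S.card := by
      rw [← card_image_sym2Mk_of_disjoint hST, Finset.card_subtype, Finset.filter_true_of_mem]
      intro e he
      obtain ⟨⟨v, u⟩, hvu, rfl⟩ := Finset.mem_image.1 he
      rw [Finset.mem_product] at hvu
      rw [Sym2.mk_isDiag_iff]
      exact fun hvu' : v = u => Finset.disjoint_left.1 hST (hvu' ▸ hvu.2 : v ∈ S) hvu.1
    rw [← hE, ← erdosRenyi_forall_eq_true h0 h1]
    refine measure_mono ?_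
    rintro ω ⟨-, hω⟩ ⟨e, hd⟩ he
    obtain ⟨⟨v, u⟩, hvu, rfl⟩ := Finset.mem_image.1 (Finset.mem_subtype.1 he)
    rw [Finset.mem_product] at hvu
    exact (hω v hvu.1 u hvu.2).2
  · simp [hST]

/-- First-moment bound for the existence of a `k`-vertex face of the `m`-neighbor complex. -/
lemma erdosRenyi_exists_isFace_le {n : ℕ} {p : ℝ} (h0 : 0 ≤ p) (h1 : p ≤ 1) (m k : ℕ) :
    erdosRenyi n p {ω | ∃ S : Finset (Fin n), S.card = k ∧ IsFace ω m S} ≤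
      (n : ENNReal) ^ (k + m) * ENNReal.ofReal p ^ (m * k) := by
  classical
  let F := Finset.powersetCard k (Finset.univ : Finset (Fin n)) ×ˢ
    Finset.powersetCard m (Finset.univ : Finset (Fin n))
  have hF : F.card ≤ n ^ (k + m) := by
    simp only [F, Finset.card_product, Finset.card_powersetCard, Finset.card_univ,
      Fintype.card_fin, pow_add]
    exact Nat.mul_le_mul (Nat.choose_le_pow n k) (Nat.choose_le_pow n m)
  calc
    _ ≤ erdosRenyi n p (⋃ q ∈ F, {ω | Disjoint q.1 q.2 ∧ ∀ v ∈ q.2, ∀ u ∈ q.1, Adj ω v u}) := by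
      refine measure_mono ?_
      rintro ω ⟨S, hS, hface⟩
      obtain ⟨T, hT, hTm⟩ := Finset.exists_subset_card_eq hface
      have hmem : ∀ v ∈ T, v ∉ S ∧ ∀ u ∈ S, Adj ω v u := fun v hv => by
        simpa [commonNbrs] using hT hv
      simp only [Set.mem_iUnion]
      exact ⟨(S, T), by simp [F, hS, hTm],
        Finset.disjoint_right.2 fun v hv => (hmem v hv).1, fun v hv => (hmem v hv).2⟩
    _ ≤ ∑ q ∈ F, erdosRenyi n p {ω | Disjoint q.1 q.2 ∧ ∀ v ∈ q.2, ∀ u ∈ q.1, Adj ω v u} :=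
      measure_biUnion_finset_le _ _
    _ ≤ ∑ _q ∈ F, ENNReal.ofReal p ^ (m * k) := by
      refine Finset.sum_le_sum fun q hq => ?_
      simp only [F, Finset.mem_product, Finset.mem_powersetCard_univ] at hq
      simpa only [hq.1, hq.2] using erdosRenyi_forall_adj_le h0 h1 q.1 q.2
    _ ≤ _ := by
      rw [Finset.sum_const, nsmul_eq_mul]
      gcongr
      exact_mod_cast hF

/-- Lemma 5, lower direction: if $0 < b < mk/(m+k)$ and $p_n = n^{-1/b}$, the probability
that some $k$-set of vertices is a face of $N_m(G(n,p_n))$ tends to $0$. -/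
theorem stmt12 (m k : ℕ) (hm : 0 < m) (hk : 0 < k) (b : ℝ) (hb0 : 0 < b)
    (hbk : b < (m : ℝ) * k / (m + k)) :
    Filter.Tendsto
      (fun n : ℕ => erdosRenyi n ((n : ℝ) ^ (-(1/b)))
        {ω | ∃ S : Finset (Fin n), S.card = k ∧ IsFace ω m S})
      Filter.atTop (nhds 0) := by
  have hmk : (0 : ℝ) < m + k := by positivity
  have hexp : 0 < (m * k : ℝ) / b - (k + m) := by
    rw [sub_pos, lt_div_iff₀ hb0, add_comm (k : ℝ), mul_comm]
    exact (lt_div_iff₀ hmk).1 hbk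
  have hlim : Filter.Tendsto
      (fun n : ℕ => ENNReal.ofReal ((n : ℝ) ^ (-((m * k : ℝ) / b - (k + m)))))
      Filter.atTop (nhds 0) := by
    simpa using ENNReal.tendsto_ofReal
      ((tendsto_rpow_neg_atTop hexp).comp tendsto_natCast_atTop_atTop)
  refine tendsto_of_tendsto_of_tendsto_of_le_of_le' tendsto_const_nhds hlim
    (Filter.Eventually.of_forall fun _ => zero_le) ?_
  filter_upwards [Filter.eventually_ge_atTop 1] with n hn
  have hn1 : (1 : ℝ) ≤ n := by exact_mod_cast hn
  have hn0 : (0 : ℝ) < n := by linarith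
  have hp0 : 0 ≤ (n : ℝ) ^ (-(1 / b)) := by positivity
  have hp1 : (n : ℝ) ^ (-(1 / b)) ≤ 1 :=
    Real.rpow_le_one_of_one_le_of_nonpos hn1 (neg_nonpos.2 (by positivity))
  refine (erdosRenyi_exists_isFace_le hp0 hp1 m k).trans_eq ?_
  rw [← ENNReal.ofReal_pow hp0, ← ENNReal.ofReal_natCast, ← ENNReal.ofReal_pow hn0.le,
    ← ENNReal.ofReal_mul (by positivity), ← Real.rpow_natCast, ← Real.rpow_natCast,
    ← Real.rpow_mul hn0.le, ← Real.rpow_add hn0]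
  congr 2
  push_cast
  ring
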